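/- arXiv:1710.10591 — 2 statements merged into one kernel-verified Lean document; each statement's English description precedes it below -/
import Mathlib

section
/- Let T > 0, let s : [0,T] → [0,∞) be absolutely continuous, let κ ∈ L¹(0,T;ℝ), and let ρ ∈ L¹(0,T;ℝ) with ρ(t) ≥ 0 for a.e. t ∈ (0,T). If s(t)s'(t) ≤ κ(t)s(t)² + ρ(t)s(t) for a.e. t ∈ (0,T), then for all t ∈ [0,T] one has s(t) ≤ s(0)·exp(∫₀ᵗ κ(τ) dτ) + ∫₀ᵗ exp(∫_σ^t κ(τ) dτ)·ρ(σ) dσ. -/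
open MeasureTheory Set

lemma ac_exp_comp {g : ℝ → ℝ} {a b : ℝ} (hg : AbsolutelyContinuousOnInterval g a b) :
    AbsolutelyContinuousOnInterval (fun x => Real.exp (g x)) a b := by
  obtain ⟨C, hC⟩ := hg.exists_bound
  have hcd : ContDiffOn ℝ 1 Real.exp (Icc (-C) C) := Real.contDiff_exp.contDiffOn
  obtain ⟨K, hK⟩ := hcd.exists_lipschitzOnWith (by decide) (convex_Icc _ _) isCompact_Icc
  unfold AbsolutelyContinuousOnInterval at hg
  refine squeeze_zero' ?_ ?_ (by simpa using hg.const_mul (K : ℝ))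
  · exact Filter.Eventually.of_forall <| fun _ ↦ Finset.sum_nonneg (fun i hi ↦ dist_nonneg)
  rw [Filter.eventually_inf_principal]
  filter_upwards with ⟨n, I⟩ hnI
  simp only [Finset.mul_sum]
  refine Finset.sum_le_sum fun i hi => ?_
  have h1 := abs_le.1 (hC _ (hnI.1 i hi).1)
  have h2 := abs_le.1 (hC _ (hnI.1 i hi).2)
  exact hK.dist_le_mul _ h1 _ h2

/-- refined Gronwall lemma, integral form: if `s` is absolutely
continuous with values in `[0,∞)`, with a.e. derivative `s' ∈ L¹(0,T)`, and
`s s' ≤ κ s² + ρ s` a.e. with `ρ ≥ 0` a.e., then for every `t ∈ [0,T]`,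
`s t ≤ s 0 · exp(∫₀ᵗ κ) + ∫₀ᵗ exp(∫_σ^t κ) ρ(σ) dσ`. -/
theorem stmt_3 (T : ℝ) (hT : 0 < T) (s s' κ ρ : ℝ → ℝ)
    (hs_nonneg : ∀ t ∈ Icc (0 : ℝ) T, 0 ≤ s t)
    (hs' : IntegrableOn s' (Ioo 0 T))
    (hκ : IntegrableOn κ (Ioo 0 T))
    (hρ : IntegrableOn ρ (Ioo 0 T))
    (hρ0 : ∀ᵐ t ∂volume.restrict (Ioo (0 : ℝ) T), 0 ≤ ρ t)
    (hAC : ∀ t ∈ Icc (0 : ℝ) T, s t = s 0 + ∫ τ in (0 : ℝ)..t, s' τ)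
    (hineq : ∀ᵐ t ∂volume.restrict (Ioo (0 : ℝ) T),
      s t * s' t ≤ κ t * (s t) ^ 2 + ρ t * s t) :
    ∀ t ∈ Icc (0 : ℝ) T,
      s t ≤ s 0 * Real.exp (∫ τ in (0 : ℝ)..t, κ τ)
        + ∫ σ in (0 : ℝ)..t, Real.exp (∫ τ in σ..t, κ τ) * ρ σ := by
  intro t ht
  have key : ∀ f : ℝ → ℝ, IntegrableOn f (Ioo 0 T) → IntervalIntegrable f volume 0 t := by
    intro f hf
    rw [intervalIntegrable_iff_integrableOn_Ioo_of_le ht.1]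
    exact hf.mono_set (Ioo_subset_Ioo_right ht.2)
  have is := key s' hs'
  have ik := key κ hκ
  have ir := key ρ hρ
  have h0 : (0 : ℝ) ∈ uIcc 0 t := left_mem_uIcc
  have hsub : ∀ x ∈ Icc 0 t, x ∈ Icc 0 T := fun x hx => ⟨hx.1, hx.2.trans ht.2⟩
  set S : ℝ → ℝ := fun x => s 0 + ∫ τ in (0 : ℝ)..x, s' τ with hS
  set G : ℝ → ℝ := fun x => Real.exp ((∫ τ in (0 : ℝ)..t, κ τ) - ∫ τ in (0 : ℝ)..x, κ τ) with hG
  have acc : ∀ c : ℝ, AbsolutelyContinuousOnInterval (fun _ => c) 0 t := fun c =>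
    (contDiffOn_const (c := c)).absolutelyContinuousOnInterval
  have acS : AbsolutelyContinuousOnInterval S 0 t :=
    (acc _).fun_add (is.absolutelyContinuousOnInterval_intervalIntegral h0)
  have acG : AbsolutelyContinuousOnInterval G 0 t :=
    ac_exp_comp ((acc _).fun_sub (ik.absolutelyContinuousOnInterval_intervalIntegral h0))
  have acf := acS.fun_mul acG
  have hint := acf.integral_deriv_eq_sub
  have iGr : IntervalIntegrable (fun σ => G σ * ρ σ) volume 0 t :=
    ir.continuousOn_mul acG.continuousOn
  have hGe : ∫ σ in (0 : ℝ)..t, Real.exp (∫ τ in σ..t, κ τ) * ρ σ = ∫ σ in (0 : ℝ)..t, G σ * ρ σ := by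
    refine intervalIntegral.integral_congr fun σ hσ => ?_
    have h1 : IntervalIntegrable κ volume 0 σ :=
      ik.mono_set (uIcc_subset_uIcc left_mem_uIcc hσ)
    simp only [hG]
    rw [intervalIntegral.integral_interval_sub_left ik h1]
  have hle : ∫ x in (0 : ℝ)..t, deriv (fun x => S x * G x) x ≤ ∫ σ in (0 : ℝ)..t, G σ * ρ σ := by
    rw [intervalIntegral.integral_of_le ht.1, intervalIntegral.integral_of_le ht.1,
      integral_Ioc_eq_integral_Ioo, integral_Ioc_eq_integral_Ioo]
    refine setIntegral_mono_ae_restrict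
      ((intervalIntegrable_iff_integrableOn_Ioo_of_le ht.1).1 acf.intervalIntegrable_deriv)
      ((intervalIntegrable_iff_integrableOn_Ioo_of_le ht.1).1 iGr) ?_
    have h1 := (ae_restrict_iff' measurableSet_Ioo).1 hρ0
    have h2 := (ae_restrict_iff' measurableSet_Ioo).1 hineq
    refine (ae_restrict_iff' measurableSet_Ioo).2 ?_
    filter_upwards [h1, h2, is.ae_hasDerivAt_integral, ik.ae_hasDerivAt_integral]
      with x h1 h2 h3 h4 hx
    have hxT : x ∈ Ioo 0 T := ⟨hx.1, hx.2.trans_le ht.2⟩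
    have hxu : x ∈ uIcc 0 t := by rw [uIcc_of_le ht.1]; exact Ioo_subset_Icc_self hx
    have dS : HasDerivAt S (s' x) x := (h3 hxu 0 h0).const_add _
    have dG : HasDerivAt G (G x * (-κ x)) x := ((h4 hxu 0 h0).const_sub _).exp
    have hSx : s x = S x := hAC x (Ioo_subset_Icc_self hxT)
    have hGp : 0 < G x := Real.exp_pos _
    have hd : deriv (fun x => S x * G x) x = s' x * G x + S x * (G x * (-κ x)) :=
      (dS.mul dG).deriv
    have h1 := h1 hxT
    have h2 := h2 hxT
    have hs0 : 0 ≤ s x := hs_nonneg x (Ioo_subset_Icc_self hxT)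
    show deriv (fun x => S x * G x) x ≤ G x * ρ x
    rw [hd, ← hSx]
    have hmain : s' x - κ x * s x ≤ ρ x := by
      rcases hs0.eq_or_lt with h | h
      · have hmin : IsLocalMin S x := by
          filter_upwards [Ioo_mem_nhds hxT.1 hxT.2] with y hy
          rw [← hSx, ← h, hS]
          have := hs_nonneg y (Ioo_subset_Icc_self hy)
          rwa [hAC y (Ioo_subset_Icc_self hy)] at this
        have := hmin.hasDerivAt_eq_zero dS
        rw [this, ← h]
        simpa using h1
      · refine le_of_mul_le_mul_left ?_ h
        nlinarith
    nlinarith [mul_le_mul_of_nonneg_left hmain hGp.le]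
  have e1 : S t = s t := (hAC t ht).symm
  have e2 : S 0 = s 0 := by simp [hS]
  have e3 : G t = 1 := by simp [hG]
  have e4 : G 0 = Real.exp (∫ τ in (0 : ℝ)..t, κ τ) := by simp [hG]
  rw [hGe, ← e4]
  rw [hint, e1, e2, e3] at hle
  linarith
end

section
/- Assume (A1), (A3), (A4) below, let V_N ⊆ V be a finite-dimensional subspace, let u_{N,0} ∈ V_N, and let u_N : [0,T] → V_N be absolutely continuous with u_N(0) = u_{N,0} such that there exists f_N ∈ L¹(0,T;H) with (u_N'(t),v) + a(u_N(t),v) = (f_N(t),v) for all v ∈ V_N and a.e. t ∈ (0,T), and f_N(t) ∈ F(t,u_N(t)) for a.e. t ∈ (0,T). Then for every t ∈ [0,T]: ‖u_N(t)‖_H ≤ ‖u_{N,0}‖_H·exp(∫₀ᵗ ℓ(τ) dτ) + ∫₀ᵗ α(σ)·exp(∫_σ^t ℓ(τ) dτ) dσ; in particular ‖u_N(t)‖_H ≤ exp(‖ℓ‖_{L¹(0,T)})·(‖u_{N,0}‖_H + ‖α‖_{L¹(0,T)}). -/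
open MeasureTheory Set Filter Metric
open scoped RealInnerProductSpace

theorem ac_of_dist_le {X Y : Type*} [PseudoMetricSpace X] [PseudoMetricSpace Y]
    {f : ℝ → X} {g : ℝ → Y} {a b K : ℝ}
    (hg : AbsolutelyContinuousOnInterval g a b)
    (h : ∀ x ∈ uIcc a b, ∀ y ∈ uIcc a b, dist (f x) (f y) ≤ K * dist (g x) (g y)) :
    AbsolutelyContinuousOnInterval f a b := by
  unfold AbsolutelyContinuousOnInterval at hg ⊢
  have h2 := hg.const_mul K
  rw [mul_zero] at h2
  refine squeeze_zero' (Eventually.of_forall fun E => Finset.sum_nonneg fun i _ => dist_nonneg) ?_ h2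
  have : ∀ᶠ E : ℕ × (ℕ → ℝ × ℝ) in AbsolutelyContinuousOnInterval.totalLengthFilter ⊓
      𝓟 (AbsolutelyContinuousOnInterval.disjWithin a b),
      E ∈ AbsolutelyContinuousOnInterval.disjWithin a b :=
    eventually_inf_principal.mpr (Eventually.of_forall fun _ h => h)
  filter_upwards [this] with E hE
  rw [Finset.mul_sum]
  refine Finset.sum_le_sum fun i hi => ?_
  have := hE.1 i hi
  exact h _ this.1 _ this.2

theorem abs_sqrt_sub_le (a b e : ℝ) (he : 0 < e) :
    |√(a ^ 2 + e ^ 2) - √(b ^ 2 + e ^ 2)| ≤ |a - b| := by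
  have ha := Real.sq_sqrt (show 0 ≤ a ^ 2 + e ^ 2 by positivity)
  have hb := Real.sq_sqrt (show 0 ≤ b ^ 2 + e ^ 2 by positivity)
  have ha0 := Real.sqrt_nonneg (a ^ 2 + e ^ 2)
  have hb0 := Real.sqrt_nonneg (b ^ 2 + e ^ 2)
  set p := √(a ^ 2 + e ^ 2)
  set q := √(b ^ 2 + e ^ 2)
  have key : a * b + e ^ 2 ≤ p * q := by
    refine abs_le_of_sq_le_sq' ?_ (by positivity) |>.2
    rw [mul_pow, ha, hb]
    nlinarith [sq_nonneg (e * (a - b))]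
  apply sq_le_sq.mp
  nlinarith

theorem gronwall_aux {H : Type*} [NormedAddCommGroup H] [InnerProductSpace ℝ H] [CompleteSpace H]
    {t : ℝ} (ht : 0 ≤ t) {w w' : ℝ → H} {α ℓ : ℝ → ℝ}
    (hα : IntervalIntegrable α volume 0 t) (hℓ : IntervalIntegrable ℓ volume 0 t)
    (hw' : IntervalIntegrable w' volume 0 t)
    (hw : ∀ s, w s = w 0 + ∫ r in (0:ℝ)..s, w' r)
    (hα0 : ∀ᵐ s, s ∈ Ioo 0 t → 0 ≤ α s)
    (hin : ∀ᵐ s, s ∈ Ioo 0 t → ⟪w s, w' s⟫ ≤ α s * ‖w s‖ + ℓ s * ‖w s‖ ^ 2) :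
    ‖w t‖ ≤ ‖w 0‖ * Real.exp (∫ τ in (0:ℝ)..t, ℓ τ)
          + (∫ σ in (0:ℝ)..t, α σ * Real.exp (∫ τ in σ..t, ℓ τ)) := by
  set L : ℝ → ℝ := fun s => ∫ τ in (0:ℝ)..s, ℓ τ with hL
  have hLac : AbsolutelyContinuousOnInterval L 0 t :=
    hℓ.absolutelyContinuousOnInterval_intervalIntegral (by simp)
  have hwac : AbsolutelyContinuousOnInterval w 0 t := by
    refine ac_of_dist_le (K := 1)
      (hw'.norm.absolutelyContinuousOnInterval_intervalIntegral (c := 0) (by simp)) ?_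
    intro x hx y hy
    have h0 : (0:ℝ) ∈ uIcc 0 t := by simp
    rw [hw x, hw y, dist_add_left, one_mul, dist_eq_norm, dist_eq_norm,
      intervalIntegral.integral_interval_sub_left (hw'.mono_set (uIcc_subset_uIcc h0 hx))
        (hw'.mono_set (uIcc_subset_uIcc h0 hy)),
      intervalIntegral.integral_interval_sub_left (hw'.norm.mono_set (uIcc_subset_uIcc h0 hx))
        (hw'.norm.mono_set (uIcc_subset_uIcc h0 hy))]
    exact intervalIntegral.norm_integral_le_abs_integral_norm
  set E : ℝ → ℝ := fun s => Real.exp (-L s) with hE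
  have hEac : AbsolutelyContinuousOnInterval E 0 t := by
    obtain ⟨C, hC⟩ := hLac.exists_bound
    have hc : ContDiffOn ℝ 1 (fun x : ℝ => Real.exp (-x)) (Icc (-C) C) := by fun_prop
    obtain ⟨K, hK⟩ := hc.exists_lipschitzOnWith (by decide) (convex_Icc _ _) isCompact_Icc
    refine ac_of_dist_le (K := K) hLac ?_
    intro x hx y hy
    exact hK.dist_le_mul _ (abs_le.mp (hC x hx)) _ (abs_le.mp (hC y hy))
  have hzac : AbsolutelyContinuousOnInterval (fun s => E s • w s) 0 t := hEac.fun_smul hwac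
  have hEα : IntervalIntegrable (fun s => α s * E s) volume 0 t :=
    hα.mul_continuousOn hEac.continuousOn
  have step : ∀ e : ℝ, 0 < e → ‖E t • w t‖ ≤ ‖E 0 • w 0‖ + e + ∫ s in (0:ℝ)..t, α s * E s := by
    intro e he
    set Φ : ℝ → ℝ := fun s => √(‖E s • w s‖ ^ 2 + e ^ 2) with hΦ
    have hΦac : AbsolutelyContinuousOnInterval Φ 0 t := by
      refine ac_of_dist_le (K := 1) hzac ?_
      intro x _ y _
      rw [one_mul, dist_eq_norm, dist_eq_norm, Real.norm_eq_abs]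
      exact (abs_sqrt_sub_le _ _ e he).trans (abs_norm_sub_norm_le _ _)
    have hint := hΦac.integral_deriv_eq_sub
    have hle : ∫ s in (0:ℝ)..t, deriv Φ s ≤ ∫ s in (0:ℝ)..t, α s * E s := by
      refine intervalIntegral.integral_mono_ae_restrict ht hΦac.intervalIntegrable_deriv hEα ?_
      rw [← restrict_Ioo_eq_restrict_Icc]
      change ∀ᵐ s ∂_, _
      rw [ae_restrict_iff' measurableSet_Ioo]
      filter_upwards [hα0, hin, hℓ.ae_hasDerivAt_integral, hw'.ae_hasDerivAt_integral]
        with s ha0 hins hLd hwd hs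
      specialize ha0 hs
      specialize hins hs
      have h0 : (0:ℝ) ∈ uIcc 0 t := by simp
      have hs' : s ∈ uIcc 0 t := by rw [uIcc_of_le ht]; exact Ioo_subset_Icc_self hs
      have hLd := hLd hs' 0 h0
      have hwd : HasDerivAt w (w' s) s := by
        have := (hwd hs' 0 h0).const_add (w 0)
        exact this.congr_of_eventuallyEq (Eventually.of_forall hw)
      have hEd : HasDerivAt E (Real.exp (-L s) * -ℓ s) s := hLd.neg.exp
      have hzd := hEd.smul hwd
      have hpos : 0 < ‖E s • w s‖ ^ 2 + e ^ 2 := by positivity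
      have hΦd : HasDerivAt Φ _ s := (hzd.norm_sq.add_const (e ^ 2)).sqrt hpos.ne'
      rw [hΦd.deriv]
      have hΦp : 0 < √(‖E s • w s‖ ^ 2 + e ^ 2) := Real.sqrt_pos.mpr hpos
      change _ / (2 * √(‖E s • w s‖ ^ 2 + e ^ 2)) ≤ _
      have h2 : ‖E s • w s‖ ≤ √(‖E s • w s‖ ^ 2 + e ^ 2) := by
        apply Real.le_sqrt_of_sq_le
        nlinarith
      rw [div_le_iff₀ (by positivity)]
      have hEp : 0 < E s := Real.exp_pos _
      have h3 : α s * E s * ‖E s • w s‖ ≤ α s * E s * √(‖E s • w s‖ ^ 2 + e ^ 2) := by gcongr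
      rw [norm_smul, Real.norm_of_nonneg hEp.le] at h3
      have h4 : ⟪(E • w) s, E s • w' s + (Real.exp (-L s) * -ℓ s) • w s⟫
          = E s ^ 2 * (⟪w s, w' s⟫ - ℓ s * ‖w s‖ ^ 2) := by
        change ⟪E s • w s, E s • w' s + (E s * -ℓ s) • w s⟫ = _
        simp only [inner_add_right, real_inner_smul_left, real_inner_smul_right,
          real_inner_self_eq_norm_sq]
        ring
      rw [h4]
      have h5 : E s ^ 2 * (⟪w s, w' s⟫ - ℓ s * ‖w s‖ ^ 2) ≤ E s ^ 2 * (α s * ‖w s‖) := by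
        gcongr
        linarith
      rw [norm_smul, Real.norm_of_nonneg hEp.le]
      nlinarith
    have h1 : Φ 0 ≤ ‖E 0 • w 0‖ + e := by
      apply Real.sqrt_le_iff.mpr
      constructor
      · positivity
      · nlinarith [norm_nonneg (E 0 • w 0)]
    have h2 : ‖E t • w t‖ ≤ Φ t := by
      apply Real.le_sqrt_of_sq_le
      nlinarith
    linarith
  have hfin : ‖E t • w t‖ ≤ ‖E 0 • w 0‖ + ∫ s in (0:ℝ)..t, α s * E s := by
    refine le_of_forall_pos_le_add fun e he => ?_
    linarith [step e he]
  have hE0 : E 0 = 1 := by simp [hE, hL]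
  have hEp : 0 < E t := Real.exp_pos _
  rw [hE0, one_smul, norm_smul, Real.norm_of_nonneg hEp.le] at hfin
  have hEt : Real.exp (L t) * E t = 1 := by
    rw [hE, ← Real.exp_add]; simp
  have hlast : ∫ σ in (0:ℝ)..t, α σ * Real.exp (∫ τ in σ..t, ℓ τ)
      = Real.exp (L t) * ∫ s in (0:ℝ)..t, α s * E s := by
    rw [← intervalIntegral.integral_const_mul]
    refine intervalIntegral.integral_congr fun σ hσ => ?_
    have h0 : (0:ℝ) ∈ uIcc 0 t := by simp
    have : ∫ τ in σ..t, ℓ τ = L t - L σ := by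
      rw [hL, intervalIntegral.integral_interval_sub_left hℓ
        (hℓ.mono_set (uIcc_subset_uIcc h0 hσ))]
    simp only [this, hE, sub_eq_add_neg, Real.exp_add]
    ring
  rw [hlast]
  calc ‖w t‖ = Real.exp (L t) * (E t * ‖w t‖) := by rw [← mul_assoc, hEt, one_mul]
    _ ≤ Real.exp (L t) * (‖w 0‖ + ∫ s in (0:ℝ)..t, α s * E s) := by gcongr
    _ = _ := by ring

/-- a priori `H`-bound for Galerkin solutions, via the refined
Gronwall lemma: `‖u_N(t)‖_H ≤ ‖u_{N,0}‖_H e^{∫₀ᵗ ℓ} + ∫₀ᵗ α(σ) e^{∫_σ^t ℓ} dσ`,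
and in particular `‖u_N(t)‖_H ≤ e^{‖ℓ‖_{L¹}} (‖u_{N,0}‖_H + ‖α‖_{L¹})`. -/
theorem stmt_5
    {V H : Type*}
    [NormedAddCommGroup V] [InnerProductSpace ℝ V] [CompleteSpace V]
    [TopologicalSpace.SeparableSpace V]
    [NormedAddCommGroup H] [InnerProductSpace ℝ H] [CompleteSpace H]
    [TopologicalSpace.SeparableSpace H]
    (ι : V →L[ℝ] H) (hι_inj : Function.Injective ι) (hι_dense : DenseRange ι)
    (hι_cpt : IsCompactOperator ι)
    (T : ℝ) (hT : 0 < T)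
    (F : ℝ → V → Set H)
    (hF : ∀ t ∈ Icc (0:ℝ) T, ∀ v : V, (F t v).Nonempty ∧ IsClosed (F t v) ∧
      Bornology.IsBounded (F t v) ∧ Convex ℝ (F t v))
    -- (A1)
    (a : V →ₗ[ℝ] V →ₗ[ℝ] ℝ) (ca Ca : ℝ) (hca : 0 < ca) (hCa : 0 < Ca)
    (hcoer : ∀ v : V, ca * ‖v‖ ^ 2 ≤ a v v)
    (habd : ∀ v w : V, a v w ≤ Ca * ‖v‖ * ‖w‖)
    -- (A3)
    (α : ℝ → ℝ) (hα : IntegrableOn α (Ioo 0 T)) (cF : ℝ) (hcF : 0 < cF)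
    (hA3 : ∀ᵐ t ∂volume.restrict (Ioo (0:ℝ) T),
      (∀ f ∈ F t 0, ‖f‖ ≤ α t) ∧
      ∀ u v : V, hausdorffDist (F t u) (F t v) ≤ cF * (1 + ‖u‖ + ‖v‖) * ‖ι u - ι v‖)
    -- (A4)
    (ℓ : ℝ → ℝ) (hℓ : IntegrableOn ℓ (Ioo 0 T))
    (hA4 : ∀ᵐ t ∂volume.restrict (Ioo (0:ℝ) T), ∀ v v2 : V, ∀ g ∈ F t v,
      ∃ g' ∈ F t v2, ⟪g - g', ι v - ι v2⟫ ≤ ℓ t * ‖ι v - ι v2‖ ^ 2)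
    -- Galerkin data
    (VN : Submodule ℝ V) (hVNfd : FiniteDimensional ℝ VN)
    (uN0 : V) (huN0 : uN0 ∈ VN)
    (uN uN' : ℝ → V)
    (huNmem : ∀ t ∈ Icc (0:ℝ) T, uN t ∈ VN)
    (huN'mem : ∀ᵐ t ∂volume.restrict (Ioo (0:ℝ) T), uN' t ∈ VN)
    (huN'int : IntegrableOn uN' (Ioo 0 T))
    (hFTC : ∀ t ∈ Icc (0:ℝ) T, uN t = uN 0 + ∫ s in (0:ℝ)..t, uN' s)
    (hinit : uN 0 = uN0)
    (fN : ℝ → H) (hfN : IntegrableOn fN (Ioo 0 T))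
    (heq : ∀ᵐ t ∂volume.restrict (Ioo (0:ℝ) T), ∀ v ∈ VN,
      ⟪ι (uN' t), ι v⟫ + a (uN t) v = ⟪fN t, ι v⟫)
    (hincl : ∀ᵐ t ∂volume.restrict (Ioo (0:ℝ) T), fN t ∈ F t (uN t)) :
    ∀ t ∈ Icc (0:ℝ) T,
      (‖ι (uN t)‖ ≤ ‖ι uN0‖ * Real.exp (∫ τ in (0:ℝ)..t, ℓ τ)
          + (∫ σ in (0:ℝ)..t, α σ * Real.exp (∫ τ in σ..t, ℓ τ))) ∧
      ‖ι (uN t)‖ ≤ Real.exp (∫ τ in Ioo (0:ℝ) T, |ℓ τ|) *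
          (‖ι uN0‖ + (∫ τ in Ioo (0:ℝ) T, |α τ|)) := by
  intro t ht
  have hint : ∀ {f : ℝ → ℝ}, IntegrableOn f (Ioo 0 T) → ∀ x ∈ Icc (0:ℝ) T, ∀ y ∈ Icc (0:ℝ) T,
      IntervalIntegrable f volume x y := by
    intro f hf x hx y hy
    have h1 : IntervalIntegrable f volume 0 T :=
      (intervalIntegrable_iff_integrableOn_Ioo_of_le hT.le).mpr hf
    exact h1.mono_set (uIcc_subset_uIcc (by rwa [uIcc_of_le hT.le]) (by rwa [uIcc_of_le hT.le]))
  have h0T : (0:ℝ) ∈ Icc (0:ℝ) T := ⟨le_rfl, hT.le⟩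
  have hu1 : IntervalIntegrable uN' volume 0 T :=
    (intervalIntegrable_iff_integrableOn_Ioo_of_le hT.le).mpr huN'int
  have hu2 : ∀ s ∈ Icc (0:ℝ) T, IntervalIntegrable uN' volume 0 s := fun s hs =>
    hu1.mono_set (uIcc_subset_uIcc (by simp) (by rwa [uIcc_of_le hT.le]))
  obtain ⟨w, hwdef⟩ : ∃ w : ℝ → H, ∀ s, w s = ι uN0 + ∫ r in (0:ℝ)..s, ι (uN' r) :=
    ⟨_, fun _ => rfl⟩
  have hw0 : w 0 = ι uN0 := by simp [hwdef]
  have hwu : ∀ s ∈ Icc (0:ℝ) T, ι (uN s) = w s := by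
    intro s hs
    rw [hwdef, hFTC s hs, map_add, hinit, ι.intervalIntegral_comp_comm (hu2 s hs)]
  rw [ae_restrict_iff' measurableSet_Ioo] at hA3 hA4 heq hincl
  have hα0 : ∀ᵐ s, s ∈ Ioo 0 T → 0 ≤ α s := by
    filter_upwards [hA3] with s h3 hs
    obtain ⟨g, hg⟩ := (hF s (Ioo_subset_Icc_self hs) 0).1
    exact (norm_nonneg g).trans ((h3 hs).1 g hg)
  have hin : ∀ᵐ s, s ∈ Ioo 0 T →
      ⟪w s, ι (uN' s)⟫ ≤ α s * ‖w s‖ + ℓ s * ‖w s‖ ^ 2 := by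
    filter_upwards [hA3, hA4, heq, hincl] with s h3 h4 h5 h6 hs
    have hs' := Ioo_subset_Icc_self hs
    obtain ⟨g, hg, hg2⟩ := h4 hs (uN s) 0 (fN s) (h6 hs)
    have hgn := (h3 hs).1 g hg
    have he := h5 hs (uN s) (huNmem s hs')
    have hc := hcoer (uN s)
    have hc0 : 0 ≤ ca * ‖uN s‖ ^ 2 := by positivity
    rw [map_zero, sub_zero, inner_sub_left] at hg2
    rw [hwu s hs'] at he hg2
    have hcs := real_inner_le_norm g (w s)
    have hm : ‖g‖ * ‖w s‖ ≤ α s * ‖w s‖ := by gcongr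
    rw [real_inner_comm]
    linarith
  have hsubt : Ioo 0 t ⊆ Ioo 0 T := Ioo_subset_Ioo_right ht.2
  have hwint : IntervalIntegrable (fun r => ι (uN' r)) volume 0 t := by
    have := hu2 t ht
    rw [intervalIntegrable_iff] at this ⊢
    exact ι.integrable_comp this
  have main : ‖ι (uN t)‖ ≤ ‖ι uN0‖ * Real.exp (∫ τ in (0:ℝ)..t, ℓ τ)
          + (∫ σ in (0:ℝ)..t, α σ * Real.exp (∫ τ in σ..t, ℓ τ)) := by
    rw [hwu t ht, ← hw0]
    refine gronwall_aux ht.1 (hint hα 0 h0T t ht) (hint hℓ 0 h0T t ht) hwint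
      (fun s => by rw [hw0, hwdef]) ?_ ?_
    · filter_upwards [hα0] with s h hs using h (hsubt hs)
    · filter_upwards [hin] with s h hs using h (hsubt hs)
  refine ⟨main, main.trans ?_⟩
  have hbd : ∀ {f : ℝ → ℝ}, IntegrableOn f (Ioo 0 T) → ∀ x ∈ Icc (0:ℝ) T, x ≤ t →
      ∫ τ in x..t, f τ ≤ ∫ τ in Ioo (0:ℝ) T, |f τ| := by
    intro f hf x hx hxt
    calc ∫ τ in x..t, f τ ≤ ∫ τ in x..t, |f τ| :=
          intervalIntegral.integral_mono_on hxt (hint hf x hx t ht) (hint hf x hx t ht).abs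
            fun y _ => le_abs_self _
      _ = ∫ τ in Ioo x t, |f τ| := by
          rw [intervalIntegral.integral_of_le hxt, integral_Ioc_eq_integral_Ioo]
      _ ≤ _ := setIntegral_mono_set hf.abs (Eventually.of_forall fun _ => abs_nonneg _)
          (Ioo_subset_Ioo hx.1 ht.2).eventuallyLE
  set M := Real.exp (∫ τ in Ioo (0:ℝ) T, |ℓ τ|) with hM
  have hMp : 0 < M := Real.exp_pos _
  have h1 : Real.exp (∫ τ in (0:ℝ)..t, ℓ τ) ≤ M := Real.exp_le_exp.mpr (hbd hℓ 0 h0T ht.1)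
  have hαt := hint hα 0 h0T t ht
  have hcont : ContinuousOn (fun σ => Real.exp (∫ τ in σ..t, ℓ τ)) (uIcc 0 t) := by
    have hc := intervalIntegral.continuousOn_primitive_interval_left
      (f := ℓ) (μ := volume) (a := 0) (b := t) ?_
    · exact hc.rexp
    · rw [uIcc_of_le ht.1, integrableOn_Icc_iff_integrableOn_Ioo]
      exact hℓ.mono_set hsubt
  have h2 : ∫ σ in (0:ℝ)..t, α σ * Real.exp (∫ τ in σ..t, ℓ τ)
      ≤ ∫ σ in (0:ℝ)..t, |α σ| * M := by
    refine intervalIntegral.integral_mono_on ht.1 (hαt.mul_continuousOn hcont)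
      (hαt.abs.mul_const M) fun σ hσ => ?_
    have hσT : σ ∈ Icc (0:ℝ) T := ⟨hσ.1, hσ.2.trans ht.2⟩
    calc α σ * Real.exp (∫ τ in σ..t, ℓ τ) ≤ |α σ| * Real.exp (∫ τ in σ..t, ℓ τ) := by
          gcongr; exact le_abs_self _
      _ ≤ |α σ| * M := by
          gcongr; exact Real.exp_le_exp.mpr (hbd hℓ σ hσT hσ.2)
  have h3 : ∫ σ in (0:ℝ)..t, |α σ| ≤ ∫ τ in Ioo (0:ℝ) T, |α τ| := by
    simpa using hbd hα.abs 0 h0T ht.1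
  rw [intervalIntegral.integral_mul_const] at h2
  have h4 : ‖ι uN0‖ * Real.exp (∫ τ in (0:ℝ)..t, ℓ τ) ≤ ‖ι uN0‖ * M := by gcongr
  have h5 : (∫ σ in (0:ℝ)..t, |α σ|) * M ≤ (∫ τ in Ioo (0:ℝ) T, |α τ|) * M := by gcongr
  linarith
end
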